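/- arXiv:2410.12529 — 4 statements merged into one kernel-verified Lean document; each statement's English description precedes it below -/
import Mathlib

section
/- Let ψ be a pure state of an n-partite system with finite-dimensional factors (n = card ι). For every k, the sum over all subsets I of the parties of cardinality k of the squared rank of the reduced density matrix ρ_I equals the corresponding sum over all subsets of cardinality n − k: ∑_{I : Finset ι, I.card = k} (ρ_I.rank)² = ∑_{I : Finset ι, I.card = card ι − k} (ρ_I.rank)². (This says the spaces of entanglement k-forms and (n−k)-forms have equal dimension.) -/
/-- The reduced density matrix of the pure state `ψ` on the subset `I` of parties. -/
noncomputable def reducedDensityMatrix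
    {ι : Type*} [Fintype ι] [DecidableEq ι] {m : ι → Type*}
    [∀ i, Fintype (m i)] [∀ i, DecidableEq (m i)]
    (ψ : (∀ i, m i) → ℂ) (I : Finset ι) :
    Matrix (∀ i : {i // i ∈ I}, m i) (∀ i : {i // i ∈ I}, m i) ℂ :=
  Matrix.of fun a b => ∑ c : ∀ i : {i // i ∉ I}, m i,
    ψ ((Equiv.piEquivPiSubtypeProd (fun i => i ∈ I) m).symm (a, c)) *
      (starRingEnd ℂ) (ψ ((Equiv.piEquivPiSubtypeProd (fun i => i ∈ I) m).symm (b, c)))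

/-- Equivalent predicates have equivalent products over their subtypes. -/
def piSubtypeEquivOfIff {ι : Type*} {p q : ι → Prop} (m : ι → Type*) (h : ∀ i, p i ↔ q i) :
    (∀ i : {i // p i}, m i) ≃ (∀ i : {i // q i}, m i) where
  toFun f i := f ⟨i, (h i).2 i.2⟩
  invFun f i := f ⟨i, (h i).1 i.2⟩
  left_inv _ := rfl
  right_inv _ := rfl

/-- The coefficients of `ψ`, as a matrix with rows indexed by the parties in `I` and columns by
the remaining parties. -/
def coefficientMatrix {ι : Type*} [DecidableEq ι] {m : ι → Type*}
    (ψ : (∀ i, m i) → ℂ) (I : Finset ι) :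
    Matrix (∀ i : {i // i ∈ I}, m i) (∀ i : {i // i ∉ I}, m i) ℂ :=
  Matrix.of fun a c => ψ ((Equiv.piEquivPiSubtypeProd (fun i => i ∈ I) m).symm (a, c))

theorem coefficientMatrix_compl {ι : Type*} [Fintype ι] [DecidableEq ι] {m : ι → Type*}
    (ψ : (∀ i, m i) → ℂ) (I : Finset ι) :
    coefficientMatrix ψ Iᶜ = (coefficientMatrix ψ I).transpose.submatrix
      (piSubtypeEquivOfIff m fun _ => Finset.mem_compl)
      (piSubtypeEquivOfIff m fun _ => by rw [Finset.mem_compl, not_not]) := by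
  ext a c
  simp only [coefficientMatrix, Matrix.of_apply, Matrix.submatrix_apply, Matrix.transpose_apply]
  congr 1
  funext i
  by_cases hi : i ∈ I <;> simp [Equiv.piEquivPiSubtypeProd, piSubtypeEquivOfIff, hi]

open scoped ComplexOrder in
theorem rank_reducedDensityMatrix {ι : Type*} [Fintype ι] [DecidableEq ι] {m : ι → Type*}
    [∀ i, Fintype (m i)] [∀ i, DecidableEq (m i)] (ψ : (∀ i, m i) → ℂ) (I : Finset ι) :
    (reducedDensityMatrix ψ I).rank = (coefficientMatrix ψ I).rank :=
  Matrix.rank_self_mul_conjTranspose (coefficientMatrix ψ I)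

/-- Complementary reductions of a pure state have the same rank. -/
theorem rank_reducedDensityMatrix_compl {ι : Type*} [Fintype ι] [DecidableEq ι] {m : ι → Type*}
    [∀ i, Fintype (m i)] [∀ i, DecidableEq (m i)] (ψ : (∀ i, m i) → ℂ) (I : Finset ι) :
    (reducedDensityMatrix ψ Iᶜ).rank = (reducedDensityMatrix ψ I).rank := by
  rw [rank_reducedDensityMatrix, rank_reducedDensityMatrix, coefficientMatrix_compl,
    Matrix.rank_submatrix, Matrix.rank_transpose]

/-- The spaces of entanglement `k`-forms and `(n-k)`-forms have equal dimension: the sum over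
all subsets of cardinality `k` of the squared ranks of the reduced density matrices equals the
corresponding sum over subsets of cardinality `n - k`. -/
theorem sum_sq_rank_eq_sum_sq_rank_complement_card
    {ι : Type*} [Fintype ι] [DecidableEq ι] {m : ι → Type*}
    [∀ i, Fintype (m i)] [∀ i, DecidableEq (m i)]
    (ψ : (∀ i, m i) → ℂ) (k : ℕ) (hk : k ≤ Fintype.card ι) :
    ∑ I ∈ Finset.univ.filter (fun I : Finset ι => I.card = k),
        (reducedDensityMatrix ψ I).rank ^ 2 =
      ∑ I ∈ Finset.univ.filter (fun I : Finset ι => I.card = Fintype.card ι - k),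
        (reducedDensityMatrix ψ I).rank ^ 2 := by
  refine Finset.sum_nbij' compl compl ?_ ?_ (fun _ _ => compl_compl _) (fun _ _ => compl_compl _)
    (fun I _ => by rw [rank_reducedDensityMatrix_compl])
  all_goals
    intro I hI
    simp only [Finset.mem_filter, Finset.mem_univ, true_and, Finset.card_compl] at hI ⊢
    omega
end

section
/- Hodge decomposition: every ω : V admits a unique decomposition ω = a + b + c with a ∈ LinearMap.range d₁ (an exact element), b ∈ LinearMap.range δ₂ (a co-exact element), and c ∈ Harm (a harmonic element). Formally: for all ω : V there exists a unique triple (a, b, c) : V × V × V with a ∈ LinearMap.range d₁, b ∈ LinearMap.range δ₂, c ∈ Harm, and ω = a + b + c. -/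
open LinearMap in
/-- The kernel of a linear map meets the range of its adjoint trivially. -/
theorem LinearMap.disjoint_ker_range_adjoint
    {𝕜 E F : Type*} [RCLike 𝕜]
    [NormedAddCommGroup E] [InnerProductSpace 𝕜 E] [FiniteDimensional 𝕜 E]
    [NormedAddCommGroup F] [InnerProductSpace 𝕜 F] [FiniteDimensional 𝕜 F]
    (T : E →ₗ[𝕜] F) : Disjoint (ker T) (range (adjoint T)) := by
  rw [← T.orthogonal_ker]
  exact Submodule.orthogonal_disjoint _

open LinearMap in
/-- Every vector is the sum of an element of the range of the adjoint and one of the kernel. -/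
theorem LinearMap.exists_mem_range_adjoint_add_mem_ker
    {𝕜 E F : Type*} [RCLike 𝕜]
    [NormedAddCommGroup E] [InnerProductSpace 𝕜 E] [FiniteDimensional 𝕜 E]
    [NormedAddCommGroup F] [InnerProductSpace 𝕜 F] [FiniteDimensional 𝕜 F]
    (T : E →ₗ[𝕜] F) (x : E) :
    ∃ y ∈ range (adjoint T), ∃ z ∈ ker T, x = y + z := by
  obtain ⟨z, hz, y, hy, rfl⟩ := (ker T).exists_add_mem_mem_orthogonal x
  exact ⟨y, T.orthogonal_ker ▸ hy, z, hz, add_comm z y⟩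

/-- Hodge decomposition: every element `ω` admits a unique decomposition `ω = a + b + c`
with `a` exact (in the range of `d₁`), `b` co-exact (in the range of `δ₂`), and `c`
harmonic. -/
theorem hodge_decomposition
    {U V W : Type*}
    [NormedAddCommGroup U] [InnerProductSpace ℂ U] [FiniteDimensional ℂ U]
    [NormedAddCommGroup V] [InnerProductSpace ℂ V] [FiniteDimensional ℂ V]
    [NormedAddCommGroup W] [InnerProductSpace ℂ W] [FiniteDimensional ℂ W]
    (d₁ : U →ₗ[ℂ] V) (d₂ : V →ₗ[ℂ] W) (hd : d₂ ∘ₗ d₁ = 0) (ω : V) :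
    ∃! abc : V × V × V,
      abc.1 ∈ LinearMap.range d₁ ∧
      abc.2.1 ∈ LinearMap.range (LinearMap.adjoint d₂) ∧
      abc.2.2 ∈ LinearMap.ker d₂ ⊓ LinearMap.ker (LinearMap.adjoint d₁) ∧
      ω = abc.1 + abc.2.1 + abc.2.2 := by
  have hδ : ∀ w, LinearMap.adjoint d₁ (LinearMap.adjoint d₂ w) = 0 := fun w => by
    rw [← LinearMap.comp_apply, ← LinearMap.adjoint_comp, hd, map_zero, LinearMap.zero_apply]
  have hd' : ∀ u, d₂ (d₁ u) = 0 := fun u => LinearMap.congr_fun hd u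
  obtain ⟨a, ha, x, hx, rfl⟩ := (LinearMap.adjoint d₁).exists_mem_range_adjoint_add_mem_ker ω
  obtain ⟨b, hb, c, hc, rfl⟩ := d₂.exists_mem_range_adjoint_add_mem_ker x
  rw [LinearMap.adjoint_adjoint] at ha
  have hc' : c ∈ LinearMap.ker (LinearMap.adjoint d₁) := by
    obtain ⟨w, rfl⟩ := hb
    simpa [hδ] using hx
  refine ⟨(a, b, c), ⟨ha, hb, ⟨hc, hc'⟩, (add_assoc a b c).symm⟩, ?_⟩
  rintro ⟨a', b', c'⟩ ⟨ha', hb', ⟨hc₂, hc₁⟩, h⟩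
  dsimp only at ha' hb' hc₂ hc₁ h
  have hbb : b - b' = 0 := by
    refine Submodule.disjoint_def.mp d₂.disjoint_ker_range_adjoint _ ?_ (sub_mem hb hb')
    obtain ⟨u, rfl⟩ := ha
    obtain ⟨u', rfl⟩ := ha'
    simpa [hd', LinearMap.mem_ker.mp hc, LinearMap.mem_ker.mp hc₂, sub_eq_zero]
      using congrArg d₂ h
  have haa : a - a' = 0 := by
    have hdisj := (LinearMap.adjoint d₁).disjoint_ker_range_adjoint
    rw [LinearMap.adjoint_adjoint] at hdisj
    refine Submodule.disjoint_def.mp hdisj _ ?_ (sub_mem ha ha')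
    obtain ⟨w, rfl⟩ := hb
    obtain ⟨w', rfl⟩ := hb'
    simpa [hδ, LinearMap.mem_ker.mp hc', LinearMap.mem_ker.mp hc₁, sub_eq_zero]
      using congrArg (LinearMap.adjoint d₁) h
  obtain rfl := sub_eq_zero.mp hbb
  obtain rfl := sub_eq_zero.mp haa
  rw [add_assoc, add_right_inj, add_right_inj] at h
  rw [h]
end

section
/- Hodge duality (dimension equality of harmonic spaces): suppose f : B ≃ₗ[ℂ] B' is a linear equivalence, there exist linear maps u : A →ₗ[ℂ] C' and v : C →ₗ[ℂ] A' with dB' ∘ₗ f = u ∘ₗ (LinearMap.adjoint dA) and (LinearMap.adjoint dA') ∘ₗ f = v ∘ₗ dB, and there exist linear maps u' : A' →ₗ[ℂ] C and v' : C' →ₗ[ℂ] A with dB ∘ₗ f.symm = u' ∘ₗ (LinearMap.adjoint dA') and (LinearMap.adjoint dA) ∘ₗ f.symm = v' ∘ₗ dB'. Then finrank ℂ Harm_B = finrank ℂ Harm_B'. -/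
open Module

/-- Hodge duality: if a linear equivalence `f : B ≃ₗ[ℂ] B'` and its inverse both intertwine
the differentials and codifferentials of the two complexes up to factoring maps, then the
harmonic subspaces have equal dimension. -/
theorem hodge_duality_finrank_harmonic_eq
    {A B C A' B' C' : Type*}
    [NormedAddCommGroup A] [InnerProductSpace ℂ A] [FiniteDimensional ℂ A]
    [NormedAddCommGroup B] [InnerProductSpace ℂ B] [FiniteDimensional ℂ B]
    [NormedAddCommGroup C] [InnerProductSpace ℂ C] [FiniteDimensional ℂ C]
    [NormedAddCommGroup A'] [InnerProductSpace ℂ A'] [FiniteDimensional ℂ A']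
    [NormedAddCommGroup B'] [InnerProductSpace ℂ B'] [FiniteDimensional ℂ B']
    [NormedAddCommGroup C'] [InnerProductSpace ℂ C'] [FiniteDimensional ℂ C']
    (dA : A →ₗ[ℂ] B) (dB : B →ₗ[ℂ] C) (dA' : A' →ₗ[ℂ] B') (dB' : B' →ₗ[ℂ] C')
    (f : B ≃ₗ[ℂ] B')
    (hu : ∃ u : A →ₗ[ℂ] C', dB' ∘ₗ (f : B →ₗ[ℂ] B') = u ∘ₗ LinearMap.adjoint dA)
    (hv : ∃ v : C →ₗ[ℂ] A', LinearMap.adjoint dA' ∘ₗ (f : B →ₗ[ℂ] B') = v ∘ₗ dB)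
    (hu' : ∃ u' : A' →ₗ[ℂ] C, dB ∘ₗ (f.symm : B' →ₗ[ℂ] B) = u' ∘ₗ LinearMap.adjoint dA')
    (hv' : ∃ v' : C' →ₗ[ℂ] A, LinearMap.adjoint dA ∘ₗ (f.symm : B' →ₗ[ℂ] B) = v' ∘ₗ dB') :
    finrank ℂ (LinearMap.ker dB ⊓ LinearMap.ker (LinearMap.adjoint dA) : Submodule ℂ B) =
      finrank ℂ (LinearMap.ker dB' ⊓ LinearMap.ker (LinearMap.adjoint dA') : Submodule ℂ B') := by
  obtain ⟨u, hu⟩ := hu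
  obtain ⟨v, hv⟩ := hv
  obtain ⟨u', hu'⟩ := hu'
  obtain ⟨v', hv'⟩ := hv'
  have map_harmonic : (LinearMap.ker dB ⊓ LinearMap.ker (LinearMap.adjoint dA)).map
      (f : B →ₗ[ℂ] B') = LinearMap.ker dB' ⊓ LinearMap.ker (LinearMap.adjoint dA') := by
    apply le_antisymm
    · rintro _ ⟨x, ⟨hx, hx'⟩, rfl⟩
      rw [SetLike.mem_coe, LinearMap.mem_ker] at hx hx'
      have h₁ := LinearMap.congr_fun hu x
      have h₂ := LinearMap.congr_fun hv x
      simp only [LinearMap.comp_apply, hx, hx', map_zero] at h₁ h₂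
      exact ⟨h₁, h₂⟩
    · rintro y ⟨hy, hy'⟩
      rw [SetLike.mem_coe, LinearMap.mem_ker] at hy hy'
      have h₁ := LinearMap.congr_fun hu' y
      have h₂ := LinearMap.congr_fun hv' y
      simp only [LinearMap.comp_apply, hy, hy', map_zero] at h₁ h₂
      exact ⟨f.symm y, ⟨h₁, h₂⟩, f.apply_symm_apply y⟩
  rw [← map_harmonic]
  exact (LinearEquiv.finrank_map_eq f _).symm
end

section
/- Equality of cohomology dimensions (abstract form of the corollary to Hodge duality): assume in addition that dB ∘ₗ dA = 0 and dB' ∘ₗ dA' = 0, that f : B ≃ₗ[ℂ] B' is a linear equivalence, that there exist linear maps u : A →ₗ[ℂ] C' and v : C →ₗ[ℂ] A' with dB' ∘ₗ f = u ∘ₗ (LinearMap.adjoint dA) and (LinearMap.adjoint dA') ∘ₗ f = v ∘ₗ dB, and that there exist linear maps u' : A' →ₗ[ℂ] C and v' : C' →ₗ[ℂ] A with dB ∘ₗ f.symm = u' ∘ₗ (LinearMap.adjoint dA') and (LinearMap.adjoint dA) ∘ₗ f.symm = v' ∘ₗ dB'. Then the dimensions of the cohomologies agree: finrank ℂ (LinearMap.ker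 dB) − finrank ℂ (LinearMap.range dA) = finrank ℂ (LinearMap.ker dB') − finrank ℂ (LinearMap.range dA'). (For the entanglement complex of an n-partite pure state, this gives dim H^k = dim H^{n−k}, explaining the symmetry of the Poincaré polynomials.) -/
open Module

/-- The kernel of the adjoint is complementary in dimension to the range. -/
theorem LinearMap.finrank_range_add_finrank_ker_adjoint {𝕜 E F : Type*} [RCLike 𝕜]
    [NormedAddCommGroup E] [InnerProductSpace 𝕜 E] [FiniteDimensional 𝕜 E]
    [NormedAddCommGroup F] [InnerProductSpace 𝕜 F] [FiniteDimensional 𝕜 F] (T : E →ₗ[𝕜] F) :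
    finrank 𝕜 (LinearMap.range T) + finrank 𝕜 (LinearMap.ker (LinearMap.adjoint T)) =
      finrank 𝕜 F := by
  rw [← LinearMap.orthogonal_range]
  exact Submodule.finrank_add_finrank_orthogonal _

/-- If `q ∘ e` factors through `p` and `p ∘ e⁻¹` factors through `q`, then the kernels of `p` and
`q` have the same dimension. -/
theorem LinearEquiv.finrank_ker_eq_of_comp_eq_comp {K M M' N N' : Type*} [Ring K]
    [AddCommGroup M] [Module K M] [AddCommGroup M'] [Module K M']
    [AddCommGroup N] [Module K N] [AddCommGroup N'] [Module K N']
    (e : M ≃ₗ[K] M') {p : M →ₗ[K] N} {q : M' →ₗ[K] N'} {g : N →ₗ[K] N'} {h : N' →ₗ[K] N}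
    (hg : q ∘ₗ (e : M →ₗ[K] M') = g ∘ₗ p) (hh : p ∘ₗ (e.symm : M' →ₗ[K] M) = h ∘ₗ q) :
    finrank K (LinearMap.ker p) = finrank K (LinearMap.ker q) := by
  have hmap : (LinearMap.ker p).map (e : M →ₗ[K] M') = LinearMap.ker q := by
    apply le_antisymm
    · rintro _ ⟨x, hx, rfl⟩
      have hx0 : p x = 0 := hx
      simpa [hx0] using LinearMap.congr_fun hg x
    · intro y hy
      have hy0 : q y = 0 := hy
      exact ⟨e.symm y, by simpa [hy0] using LinearMap.congr_fun hh y, e.apply_symm_apply y⟩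
  rw [← hmap]
  exact (LinearEquiv.finrank_map_eq e _).symm

/-- Equality of cohomology dimensions (corollary of Hodge duality): for two three-term
cochain complexes of finite-dimensional complex Hilbert spaces related by a linear
equivalence `f` that intertwines differentials and codifferentials up to factoring maps
(in both directions), the dimensions of the cohomologies agree:
`dim(ker dB) − dim(im dA) = dim(ker dB') − dim(im dA')`. -/
theorem hodge_duality_cohomology_dim_eq
    {A B C A' B' C' : Type*}
    [NormedAddCommGroup A] [InnerProductSpace ℂ A] [FiniteDimensional ℂ A]
    [NormedAddCommGroup B] [InnerProductSpace ℂ B] [FiniteDimensional ℂ B]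
    [NormedAddCommGroup C] [InnerProductSpace ℂ C] [FiniteDimensional ℂ C]
    [NormedAddCommGroup A'] [InnerProductSpace ℂ A'] [FiniteDimensional ℂ A']
    [NormedAddCommGroup B'] [InnerProductSpace ℂ B'] [FiniteDimensional ℂ B']
    [NormedAddCommGroup C'] [InnerProductSpace ℂ C'] [FiniteDimensional ℂ C']
    (dA : A →ₗ[ℂ] B) (dB : B →ₗ[ℂ] C) (dA' : A' →ₗ[ℂ] B') (dB' : B' →ₗ[ℂ] C')
    (hcx : dB ∘ₗ dA = 0) (hcx' : dB' ∘ₗ dA' = 0)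
    (f : B ≃ₗ[ℂ] B')
    (hu : ∃ u : A →ₗ[ℂ] C', dB' ∘ₗ (f : B →ₗ[ℂ] B') = u ∘ₗ LinearMap.adjoint dA)
    (hv : ∃ v : C →ₗ[ℂ] A', LinearMap.adjoint dA' ∘ₗ (f : B →ₗ[ℂ] B') = v ∘ₗ dB)
    (hu' : ∃ u' : A' →ₗ[ℂ] C, dB ∘ₗ (f.symm : B' →ₗ[ℂ] B) = u' ∘ₗ LinearMap.adjoint dA')
    (hv' : ∃ v' : C' →ₗ[ℂ] A, LinearMap.adjoint dA ∘ₗ (f.symm : B' →ₗ[ℂ] B) = v' ∘ₗ dB') :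
    finrank ℂ (LinearMap.ker dB) - finrank ℂ (LinearMap.range dA) =
      finrank ℂ (LinearMap.ker dB') - finrank ℂ (LinearMap.range dA') := by
  obtain ⟨u, hu⟩ := hu
  obtain ⟨v, hv⟩ := hv
  obtain ⟨u', hu'⟩ := hu'
  obtain ⟨v', hv'⟩ := hv'
  have hker := f.finrank_ker_eq_of_comp_eq_comp hu hv'
  have hker' := f.finrank_ker_eq_of_comp_eq_comp hv hu'
  have hrank := dA.finrank_range_add_finrank_ker_adjoint
  have hrank' := dA'.finrank_range_add_finrank_ker_adjoint
  have hdim := f.finrank_eq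
  omega
end
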